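/- arXiv:2205.08693 — 6 statements merged into one kernel-verified Lean document; each statement's English description precedes it below -/
import Mathlib

section
/- The abelianization of Γ^(2) is isomorphic to ℤ × ℤ/11ℤ. -/
/-- The generator `a` of the free group on two generators. -/
private def a : FreeGroup (Fin 2) := FreeGroup.of 0

/-- The generator `b` of the free group on two generators. -/
private def b : FreeGroup (Fin 2) := FreeGroup.of 1

/-- The word `w = a·b·a·b⁻¹·a⁻¹·b⁻¹·a⁻¹·b·a·b`. -/
private def w : FreeGroup (Fin 2) := a * b * a * b⁻¹ * a⁻¹ * b⁻¹ * a⁻¹ * b * a * b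

/-- The word `w* = b·a·b·a⁻¹·b⁻¹·a⁻¹·b⁻¹·a·b·a`. -/
private def wstar : FreeGroup (Fin 2) := b * a * b * a⁻¹ * b⁻¹ * a⁻¹ * b⁻¹ * a * b * a

/-- `Γ = ⟨a, b ∣ w·a·w⁻¹·b⁻¹, a⁻⁴·w·w*⟩`, the fundamental group of 0-surgery on the knot 6₂. -/
private abbrev Gamma : Type :=
  PresentedGroup ({w * a * w⁻¹ * b⁻¹, a ^ (-4 : ℤ) * w * wstar} : Set (FreeGroup (Fin 2)))

/-- `Γ^(2)`, the subgroup of `Γ` generated by all squares. -/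
private def GammaSq : Subgroup Gamma := Subgroup.closure {x : Gamma | ∃ g : Gamma, g ^ 2 = x}

namespace GammaProof

/-- Class of `a` in `Γ`. -/
def A : Gamma := PresentedGroup.of 0

/-- Class of `b` in `Γ`. -/
def B : Gamma := PresentedGroup.of 1

/-- Class of `w` in `Γ`. -/
def W : Gamma := A * B * A * B⁻¹ * A⁻¹ * B⁻¹ * A⁻¹ * B * A * B

/-- Class of `w*` in `Γ`. -/
def Ws : Gamma := B * A * B * A⁻¹ * B⁻¹ * A⁻¹ * B⁻¹ * A * B * A

theorem rel1 : W * A * W⁻¹ * B⁻¹ = 1 := by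
  have h : (PresentedGroup.mk ({w * a * w⁻¹ * b⁻¹, a ^ (-4 : ℤ) * w * wstar} :
      Set (FreeGroup (Fin 2)))) (w * a * w⁻¹ * b⁻¹) = 1 :=
    PresentedGroup.one_of_mem (by simp)
  exact h

theorem rel2 : A ^ (-4 : ℤ) * W * Ws = 1 := by
  have h : (PresentedGroup.mk ({w * a * w⁻¹ * b⁻¹, a ^ (-4 : ℤ) * w * wstar} :
      Set (FreeGroup (Fin 2)))) (a ^ (-4 : ℤ) * w * wstar) = 1 :=
    PresentedGroup.one_of_mem (by simp)
  exact h

/-- The images of the generators in `ℤ × D₁₁`. -/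
def gens : Fin 2 → Multiplicative ℤ × DihedralGroup 11 :=
  ![(Multiplicative.ofAdd 1, DihedralGroup.sr 0), (Multiplicative.ofAdd 1, DihedralGroup.sr (-1))]

/-- The homomorphism `Γ → ℤ × D₁₁`. -/
def phi : Gamma →* Multiplicative ℤ × DihedralGroup 11 :=
  PresentedGroup.toGroup (f := gens) (by
    intro r hr
    rcases hr with rfl | rfl
    · simp only [w, a, b, map_mul, map_inv, FreeGroup.lift_apply_of, gens]
      decide
    · simp only [w, wstar, a, b, map_mul, map_inv, map_zpow, FreeGroup.lift_apply_of, gens]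
      decide)

theorem phi_A : phi A = (Multiplicative.ofAdd 1, DihedralGroup.sr 0) :=
  PresentedGroup.toGroup.of _

theorem phi_B : phi B = (Multiplicative.ofAdd 1, DihedralGroup.sr (-1)) :=
  PresentedGroup.toGroup.of _

theorem sq_mem (g : Gamma) : g ^ 2 ∈ GammaSq := Subgroup.subset_closure ⟨g, rfl⟩

theorem x_mem : A ^ 2 ∈ GammaSq := sq_mem A

theorem y_mem : B * A⁻¹ ∈ GammaSq := by
  have h : B = W * A * W⁻¹ := (mul_inv_eq_one.mp rel1).symm
  have h2 : B * A⁻¹ = W ^ 2 * (W⁻¹ * A) ^ 2 * (A ^ 2)⁻¹ := by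
    rw [h]; simp only [pow_two]; group
  rw [h2]
  exact mul_mem (mul_mem (sq_mem _) (sq_mem _)) (inv_mem (sq_mem _))

theorem z_mem : A * B ∈ GammaSq := by
  have h2 : A * B = (A * (B * A⁻¹)) ^ 2 * (B * A⁻¹)⁻¹ := by
    simp only [pow_two]; group
  rw [h2]
  exact mul_mem (sq_mem _) (inv_mem y_mem)

/-- The rotation part of squares. -/
theorem phi_mem (g : Gamma) (hg : g ∈ GammaSq) :
    (phi g).2 ∈ Subgroup.zpowers (DihedralGroup.r 1 : DihedralGroup 11) := by
  have h : GammaSq ≤ (Subgroup.zpowers (DihedralGroup.r 1 : DihedralGroup 11)).comap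
      ((MonoidHom.snd _ _).comp phi) := by
    unfold GammaSq
    rw [Subgroup.closure_le]
    rintro _ ⟨g, rfl⟩
    have key : ∀ d : DihedralGroup 11, d ^ 2 ∈ Subgroup.zpowers (DihedralGroup.r 1 : DihedralGroup 11) := by
      rintro (i | i)
      · refine Subgroup.mem_zpowers_iff.mpr ⟨((i + i).val : ℤ), ?_⟩
        rw [zpow_natCast, DihedralGroup.r_one_pow, ZMod.natCast_zmod_val, pow_two,
          DihedralGroup.r_mul_r]
      · rw [pow_two, DihedralGroup.sr_mul_self]
        exact one_mem _
    simpa using key (phi g).2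
  exact h hg

theorem sr_notMem : (DihedralGroup.sr 0 : DihedralGroup 11) ∉
    Subgroup.zpowers (DihedralGroup.r 1 : DihedralGroup 11) := by
  intro h
  obtain ⟨n, hn⟩ := Subgroup.mem_zpowers_iff.mp h
  rw [DihedralGroup.r_one_zpow] at hn
  cases hn

theorem A_notMem : A ∉ GammaSq := fun h => sr_notMem (by simpa [phi_A] using phi_mem A h)

/-- The Schreier generators. -/
def N : Subgroup Gamma := Subgroup.closure {A ^ 2, B * A⁻¹, A * B}

theorem N_le : N ≤ GammaSq := by
  unfold N
  rw [Subgroup.closure_le]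
  rintro _ (rfl | rfl | rfl)
  · exact x_mem
  · exact y_mem
  · exact z_mem

theorem coset (g : Gamma) : g ∈ N ∨ g * A⁻¹ ∈ N := by
  have hx : A ^ 2 ∈ N := Subgroup.subset_closure (by simp)
  have hy : B * A⁻¹ ∈ N := Subgroup.subset_closure (by simp)
  have hz : A * B ∈ N := Subgroup.subset_closure (by simp)
  have htop : g ∈ Subgroup.closure (Set.range (PresentedGroup.of (rels :=
      ({w * a * w⁻¹ * b⁻¹, a ^ (-4 : ℤ) * w * wstar} : Set (FreeGroup (Fin 2)))))) := by
    rw [PresentedGroup.closure_range_of]; trivial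
  induction htop using Subgroup.closure_induction_right with
  | one => exact Or.inl (one_mem _)
  | mul_right u v hu hv ih =>
    obtain ⟨i, rfl⟩ := hv
    fin_cases i
    · change u * A ∈ N ∨ u * A * A⁻¹ ∈ N
      rcases ih with h | h
      · right; simpa using h
      · left
        have := mul_mem h hx
        simpa [pow_two, mul_assoc] using this
    · change u * B ∈ N ∨ u * B * A⁻¹ ∈ N
      rcases ih with h | h
      · right; simpa [mul_assoc] using mul_mem h hy
      · left; simpa [mul_assoc] using mul_mem h hz
  | mul_inv_cancel u v hu hv ih =>
    obtain ⟨i, rfl⟩ := hv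
    fin_cases i
    · change u * A⁻¹ ∈ N ∨ u * A⁻¹ * A⁻¹ ∈ N
      rcases ih with h | h
      · right; simpa [mul_assoc, pow_two] using mul_mem h (inv_mem hx)
      · left; exact h
    · change u * B⁻¹ ∈ N ∨ u * B⁻¹ * A⁻¹ ∈ N
      rcases ih with h | h
      · right; simpa [mul_assoc] using mul_mem h (inv_mem hz)
      · left; simpa [mul_assoc] using mul_mem h (inv_mem hy)

theorem N_eq : N = GammaSq := by
  refine le_antisymm N_le fun g hg => ?_
  rcases coset g with h | h
  · exact h
  · exfalso
    apply A_notMem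
    simpa using mul_mem (inv_mem (N_le h)) hg

/-- `a²` in `Γ^(2)`. -/
def x : GammaSq := ⟨A ^ 2, x_mem⟩

/-- `b a⁻¹` in `Γ^(2)`. -/
def y : GammaSq := ⟨B * A⁻¹, y_mem⟩

/-- `a b` in `Γ^(2)`. -/
def z : GammaSq := ⟨A * B, z_mem⟩

theorem eq1 : z * y⁻¹ * x⁻¹ * y⁻¹ * x⁻¹ * z * z * y⁻¹ * x⁻¹ * y⁻¹ * z * z * x⁻¹ * y⁻¹ * x⁻¹ * y⁻¹
    = 1 := by
  apply Subtype.ext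
  rw [← Subgroup.subtype_apply, ← Subgroup.subtype_apply]
  simp only [map_mul, map_inv, map_one, Subgroup.subtype_apply, x, y, z]
  rw [← rel1]
  simp only [W]
  group

theorem eq2 : x⁻¹ * x⁻¹ * z * y⁻¹ * x⁻¹ * y⁻¹ * x⁻¹ * z * z * y * x * y * z⁻¹ * z⁻¹ * x * y * x
    = 1 := by
  apply Subtype.ext
  rw [← Subgroup.subtype_apply, ← Subgroup.subtype_apply]
  simp only [map_mul, map_inv, map_one, Subgroup.subtype_apply, x, y, z]
  rw [← rel2]
  simp only [W, Ws]
  group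

/-- Class of `x` in the abelianization, additively. -/
def X : Additive (Abelianization GammaSq) := Additive.ofMul (Abelianization.of x)

/-- Class of `y` in the abelianization, additively. -/
def Y : Additive (Abelianization GammaSq) := Additive.ofMul (Abelianization.of y)

/-- Class of `z` in the abelianization, additively. -/
def Z : Additive (Abelianization GammaSq) := Additive.ofMul (Abelianization.of z)

theorem Z_eq : Z = X - Y := by
  have h := congrArg (fun g => Additive.ofMul (Abelianization.of g)) eq2
  simp only [map_mul, map_inv, map_one, ofMul_mul, ofMul_inv, ofMul_one] at h
  change -X + -X + Z + -Y + -X + -Y + -X + Z + Z + Y + X + Y + -Z + -Z + X + Y + X = 0 at h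
  have h2 : Z - (X - Y) = 0 := by rw [← h]; abel
  exact sub_eq_zero.mp h2

theorem Y_eq : (11 : ℤ) • Y = 0 := by
  have h := congrArg (fun g => Additive.ofMul (Abelianization.of g)) eq1
  simp only [map_mul, map_inv, map_one, ofMul_mul, ofMul_inv, ofMul_one] at h
  change Z + -Y + -X + -Y + -X + Z + Z + -Y + -X + -Y + Z + Z + -X + -Y + -X + -Y = 0 at h
  rw [Z_eq] at h
  rw [← neg_eq_zero, ← h]
  abel

/-- The map `ℤ × ℤ/11 → (Γ^(2))^ab`. -/
def F : ℤ × ZMod 11 →+ Additive (Abelianization GammaSq) :=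
  AddMonoidHom.coprod (zmultiplesHom _ X)
    (ZMod.lift 11 ⟨zmultiplesHom _ Y, by simpa using Y_eq⟩)

theorem F_apply (n m : ℤ) : F (n, (m : ZMod 11)) = n • X + m • Y := by
  simp [F]

theorem F_surj : Function.Surjective F := by
  have hall : ∀ (g : Gamma) (hg : g ∈ N),
      Additive.ofMul (Abelianization.of (⟨g, N_le hg⟩ : GammaSq)) ∈ F.range := by
    intro g hg
    unfold N at hg
    induction hg using Subgroup.closure_induction with
    | mem g hg =>
      rcases hg with rfl | rfl | rfl
      · exact ⟨(1, ((0 : ℤ) : ZMod 11)), by rw [F_apply]; simp [X, x]⟩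
      · exact ⟨(0, ((1 : ℤ) : ZMod 11)), by rw [F_apply]; simp [Y, y]⟩
      · refine ⟨(1, ((-1 : ℤ) : ZMod 11)), ?_⟩
        rw [F_apply]
        change _ = Z
        rw [Z_eq, one_smul, neg_smul, one_smul, sub_eq_add_neg]
    | one => exact zero_mem _
    | mul g h hg hh ihg ihh => exact add_mem ihg ihh
    | inv g hg ih => exact neg_mem ih
  intro t
  obtain ⟨⟨g, hg⟩, hgt⟩ := QuotientGroup.mk_surjective (Additive.toMul t)
  have hg' : g ∈ N := by rw [N_eq]; exact hg
  obtain ⟨p, hp⟩ := hall g hg'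
  exact ⟨p, hp.trans hgt⟩

theorem comm_ker : commutator GammaSq ≤ (phi.comp GammaSq.subtype).ker := by
  rw [commutator_def, Subgroup.commutator_le]
  intro g _ h _
  rw [MonoidHom.mem_ker, map_commutatorElement, commutatorElement_eq_one_iff_mul_comm]
  refine Prod.ext (mul_comm _ _) ?_
  obtain ⟨i, hi⟩ := Subgroup.mem_zpowers_iff.mp (phi_mem g g.2)
  obtain ⟨j, hj⟩ := Subgroup.mem_zpowers_iff.mp (phi_mem h h.2)
  change (phi g).2 * (phi h).2 = (phi h).2 * (phi g).2
  rw [← hi, ← hj, ← zpow_add, ← zpow_add, add_comm]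

theorem F_inj : Function.Injective F := by
  rw [injective_iff_map_eq_zero]
  rintro ⟨n, m⟩ h
  obtain ⟨m, rfl⟩ := ZMod.intCast_surjective m
  rw [F_apply] at h
  have h1 : Abelianization.of (x ^ n * y ^ m) = 1 := by
    rw [map_mul, map_zpow, map_zpow]
    exact h
  have h2 : x ^ n * y ^ m ∈ commutator GammaSq := (QuotientGroup.eq_one_iff _).mp h1
  have h3 := comm_ker h2
  rw [MonoidHom.mem_ker, map_mul, map_zpow, map_zpow] at h3
  have hx : (phi.comp GammaSq.subtype) x = (Multiplicative.ofAdd 2, 1) := by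
    change phi (A ^ 2) = _
    rw [map_pow, phi_A]; decide
  have hy : (phi.comp GammaSq.subtype) y = (1, DihedralGroup.r 1) := by
    change phi (B * A⁻¹) = _
    rw [map_mul, map_inv, phi_A, phi_B]; decide
  rw [hx, hy, Prod.ext_iff] at h3
  obtain ⟨h4, h5⟩ := h3
  simp only [Prod.fst_mul, Prod.snd_mul, Prod.pow_fst, Prod.pow_snd, one_zpow, mul_one, one_mul,
    Prod.fst_one, Prod.snd_one, DihedralGroup.r_one_zpow] at h4 h5
  have h6 : n * 2 = 0 := by
    have := congrArg Multiplicative.toAdd h4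
    simpa using this
  have h7 : n = 0 := by omega
  have h8 : (m : ZMod 11) = 0 := DihedralGroup.r.inj h5
  rw [h7, h8]; rfl

end GammaProof

/-- The abelianization of `Γ^(2)` is isomorphic to `ℤ × ℤ/11ℤ`. -/
theorem GammaSq_abelianization :
    Nonempty (Abelianization GammaSq ≃* Multiplicative (ℤ × ZMod 11)) := by
  exact ⟨(AddEquiv.toMultiplicativeLeft
    (AddEquiv.ofBijective GammaProof.F ⟨GammaProof.F_inj, GammaProof.F_surj⟩)).symm⟩
end

section
/- The abelianization of Γ'^(2) is isomorphic to ℤ × ℤ/13ℤ. -/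
/-- The word `w' = a·b·a⁻¹·b⁻¹·a⁻¹·b·a·b⁻¹·a⁻¹·b⁻¹·a·b`. -/
private def w' : FreeGroup (Fin 2) :=
  a * b * a⁻¹ * b⁻¹ * a⁻¹ * b * a * b⁻¹ * a⁻¹ * b⁻¹ * a * b

/-- The word `w'* = b·a·b⁻¹·a⁻¹·b⁻¹·a·b·a⁻¹·b⁻¹·a⁻¹·b·a`. -/
private def w'star : FreeGroup (Fin 2) :=
  b * a * b⁻¹ * a⁻¹ * b⁻¹ * a * b * a⁻¹ * b⁻¹ * a⁻¹ * b * a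

/-- `Γ' = ⟨a, b ∣ w'·a·w'⁻¹·b⁻¹, w'·w'*⟩`, the fundamental group of 0-surgery on the knot 6₃. -/
private abbrev Gamma' : Type :=
  PresentedGroup ({w' * a * w'⁻¹ * b⁻¹, w' * w'star} : Set (FreeGroup (Fin 2)))

/-- `Γ'^(2)`, the subgroup of `Γ'` generated by all squares. -/
private def Gamma'Sq : Subgroup Gamma' := Subgroup.closure {x : Gamma' | ∃ g : Gamma', g ^ 2 = x}


/-- The two key consequences of the relation, in a group where squares commute. -/
theorem aux_rel {Q : Type*} [Group Q] (t y u : Q) (hu : u = t * y * t⁻¹)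
    (h2 : Commute (t * t) y) (hc : Commute u y)
    (hr : (t * (y * t) * t⁻¹ * (y * t)⁻¹ * t⁻¹ * (y * t) * t * (y * t)⁻¹ * t⁻¹ * (y * t)⁻¹ * t *
      (y * t)) * t = (y * t) * (t * (y * t) * t⁻¹ * (y * t)⁻¹ * t⁻¹ * (y * t) * t * (y * t)⁻¹ * t⁻¹
        * (y * t)⁻¹ * t * (y * t))) :
    u = y⁻¹ ∧ y ^ 13 = 1 := by
  have e1 : t * y = u * t := by rw [hu]; group
  have e2 : t * u = y * t := by
    have h := h2.eq
    calc t * u = (t * t * y) * t⁻¹ := by rw [hu]; group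
      _ = y * t := by rw [h]; group
  have e2' : t⁻¹ * y * t = u := by
    rw [mul_assoc, ← e2]; group
  have hw : t * (y * t) * t⁻¹ * (y * t)⁻¹ * t⁻¹ * (y * t) * t * (y * t)⁻¹ * t⁻¹ * (y * t)⁻¹ * t *
      (y * t) = (u * y⁻¹) ^ 3 := by
    have p3 : t⁻¹ * t⁻¹ * y⁻¹ * t * y * t = u * y⁻¹ := by
      have h3 : t * y * t = u * (t * t) := by rw [e1]; group
      have h4 : Commute (t * t) u := by
        change t * t * u = u * (t * t)
        rw [mul_assoc, e2, ← mul_assoc, e1, mul_assoc]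
      have h5 : Commute (t * t) (y⁻¹ * u) := (h2.inv_right).mul_right h4
      calc t⁻¹ * t⁻¹ * y⁻¹ * t * y * t = (t * t)⁻¹ * (y⁻¹ * (t * y * t)) := by group
        _ = (t * t)⁻¹ * ((y⁻¹ * u) * (t * t)) := by rw [h3]; group
        _ = y⁻¹ * u := by rw [← h5.eq]; group
        _ = u * y⁻¹ := (hc.inv_right.eq).symm
    calc _ = (t * y * t⁻¹ * y⁻¹) * (t⁻¹ * y * t * y⁻¹) * (t⁻¹ * t⁻¹ * y⁻¹ * t * y * t) := by group
      _ = (u * y⁻¹) ^ 3 := by rw [p3, e2', ← hu, pow_succ, pow_two]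
  rw [hw] at hr
  have hs : t * (u * y⁻¹) = (y * u⁻¹) * t := by
    calc t * (u * y⁻¹) = (t * u) * t⁻¹ * (t * y * t⁻¹)⁻¹ * t := by group
      _ = (y * u⁻¹) * t := by rw [e2, ← hu]; group
  have hsc : t * (u * y⁻¹) * t⁻¹ = (u * y⁻¹)⁻¹ := by rw [hs]; group
  have hs3 : t * (u * y⁻¹) ^ 3 * t⁻¹ = ((u * y⁻¹) ^ 3)⁻¹ := by
    rw [← conj_pow, hsc, inv_pow]
  have hr2 : (u * y⁻¹) ^ 6 = y := by
    have : y = (u * y⁻¹) ^ 3 * (t * (u * y⁻¹) ^ 3 * t⁻¹)⁻¹ := by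
      calc y = (y * t * (u * y⁻¹) ^ 3) * ((u * y⁻¹) ^ 3)⁻¹ * t⁻¹ := by group
        _ = _ := by rw [← hr]; group
    rw [hs3, inv_inv, ← pow_add] at this
    exact this.symm
  have huy : u = y⁻¹ := by
    rw [hu]
    conv_lhs => rw [← hr2]
    rw [← conj_pow, hsc, inv_pow, hr2]
  refine ⟨huy, ?_⟩
  rw [huy] at hr2
  have : y ^ 13 = y * ((y⁻¹ * y⁻¹) ^ 6)⁻¹ := by group
  rw [this, hr2]; group

theorem aux_swap {Q : Type*} [Group Q] (t y : Q) (h : t * y * t⁻¹ = y⁻¹) (j : ℤ) :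
    ∀ k : ℤ, ∃ k' : ℤ, t ^ j * y ^ k = y ^ k' * t ^ j := by
  have h1 : ∀ k : ℤ, t * y ^ k = y ^ (-k) * t := by
    intro k
    have : t * y ^ k * t⁻¹ = y ^ (-k) := by rw [← conj_zpow, h]; simp
    rw [← this]; group
  have h2 : ∀ k : ℤ, t⁻¹ * y ^ k = y ^ (-k) * t⁻¹ := by
    intro k
    have := h1 (-k)
    rw [neg_neg] at this
    rw [inv_mul_eq_iff_eq_mul, ← mul_assoc, this]; group
  induction j using Int.induction_on with
  | zero => intro k; exact ⟨k, by simp⟩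
  | succ i ih =>
    intro k
    obtain ⟨k', hk⟩ := ih (-k)
    exact ⟨k', by rw [zpow_add_one, mul_assoc, h1, ← mul_assoc, hk, mul_assoc]⟩
  | pred i ih =>
    intro k
    obtain ⟨k', hk⟩ := ih (-k)
    exact ⟨k', by rw [zpow_sub_one, mul_assoc, h2, ← mul_assoc, hk, mul_assoc]⟩

/-- images of generators -/
private def gens : Fin 2 → DihedralGroup 13 × Multiplicative ℤ :=
  ![(.sr 0, Multiplicative.ofAdd 1), (.sr 12, Multiplicative.ofAdd 1)]

private theorem gens_rel : ∀ r ∈ ({w' * a * w'⁻¹ * b⁻¹, w' * w'star} : Set (FreeGroup (Fin 2))),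
    FreeGroup.lift gens r = 1 := by
  intro r hr
  rcases hr with rfl | rfl
  · simp only [w', a, b, map_mul, map_inv, FreeGroup.lift_apply_of]
    decide
  · simp only [w', w'star, a, b, map_mul, map_inv, FreeGroup.lift_apply_of]
    decide

private def psi : Gamma' →* DihedralGroup 13 × Multiplicative ℤ :=
  PresentedGroup.toGroup gens_rel

private def tt : Gamma' := PresentedGroup.of 0
private def bb : Gamma' := PresentedGroup.of 1

private theorem psi_tt : psi tt = (.sr 0, Multiplicative.ofAdd 1) := by
  simp [psi, tt, gens]
private theorem psi_bb : psi bb = (.sr 12, Multiplicative.ofAdd 1) := by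
  simp [psi, bb, gens]
private theorem psi_y : psi (bb * tt⁻¹) = (.r 1, 1) := by
  rw [map_mul, map_inv, psi_tt, psi_bb]; decide

private theorem psi_y_zpow (i : ℤ) : psi ((bb * tt⁻¹) ^ i) = (.r i, 1) := by
  rw [map_zpow, psi_y]
  ext1
  · simp
  · simp

private theorem sq_mem (g : Gamma') : g ^ 2 ∈ Gamma'Sq := Subgroup.subset_closure ⟨g, rfl⟩

private theorem sq_mem' (g : Gamma') : g * g ∈ Gamma'Sq := by
  rw [← pow_two]; exact sq_mem g

private instance sq_normal : Gamma'Sq.Normal := by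
  constructor
  intro n hn g
  have : g * n * g⁻¹ = (g * n) * (g * n) * ((n⁻¹) * (g⁻¹ * g⁻¹)) := by group
  rw [this]
  exact mul_mem (sq_mem' _) (mul_mem (inv_mem hn) (sq_mem' _))

private def ww : Gamma' :=
  tt * bb * tt⁻¹ * bb⁻¹ * tt⁻¹ * bb * tt * bb⁻¹ * tt⁻¹ * bb⁻¹ * tt * bb

private theorem ww_rel : ww * tt = bb * ww := by
  have h : PresentedGroup.mk ({w' * a * w'⁻¹ * b⁻¹, w' * w'star} : Set (FreeGroup (Fin 2)))
      (w' * a * w'⁻¹ * b⁻¹) = 1 :=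
    PresentedGroup.one_of_mem (by simp)
  have h2 : ww * tt * ww⁻¹ * bb⁻¹ = 1 := h
  rw [mul_inv_eq_one, mul_inv_eq_iff_eq_mul] at h2
  exact h2

private theorem y_mem : bb * tt⁻¹ ∈ Gamma'Sq := by
  have : bb * tt⁻¹ = (ww * ww) * ((ww⁻¹ * tt) * (ww⁻¹ * tt)) * (tt⁻¹ * tt⁻¹) := by
    have : bb = ww * tt * ww⁻¹ := by rw [ww_rel]; group
    rw [this]; group
  rw [this]
  exact mul_mem (mul_mem (sq_mem' _) (sq_mem' _)) (sq_mem' _)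

private abbrev NN : Subgroup Gamma' := ⁅Gamma'Sq, Gamma'Sq⁆

private theorem comm_Q {g h : Gamma'} (hg : g ∈ Gamma'Sq) (hh : h ∈ Gamma'Sq) :
    Commute (QuotientGroup.mk' NN g) (QuotientGroup.mk' NN h) := by
  rw [← commutatorElement_eq_one_iff_commute, ← map_commutatorElement]
  exact (QuotientGroup.eq_one_iff _).2 (Subgroup.commutator_mem_commutator hg hh)

private theorem rel_Q :
    QuotientGroup.mk' NN (tt * (bb * tt⁻¹) * tt⁻¹) = (QuotientGroup.mk' NN (bb * tt⁻¹))⁻¹ ∧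
    (QuotientGroup.mk' NN (bb * tt⁻¹)) ^ 13 = 1 := by
  apply aux_rel (QuotientGroup.mk' NN tt) (QuotientGroup.mk' NN (bb * tt⁻¹))
  · simp only [map_mul, map_inv]
  · rw [← map_mul]; exact comm_Q (sq_mem' _) y_mem
  · exact comm_Q (sq_normal.conj_mem _ y_mem _) y_mem
  · have h := congrArg (QuotientGroup.mk' NN) ww_rel
    have hb : QuotientGroup.mk' NN (bb * tt⁻¹) * QuotientGroup.mk' NN tt
      = QuotientGroup.mk' NN bb := by rw [← map_mul]; simp
    rw [hb]
    simpa only [ww, map_mul, map_inv] using h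

private theorem normal_form (g : Gamma') : ∃ i j : ℤ,
    QuotientGroup.mk' NN g = QuotientGroup.mk' NN ((bb * tt⁻¹) ^ i * tt ^ j) := by
  have hsw := aux_swap (QuotientGroup.mk' NN tt) (QuotientGroup.mk' NN (bb * tt⁻¹))
    (by rw [← rel_Q.1]; simp only [map_mul, map_inv])
  suffices H : ∃ i j : ℤ, QuotientGroup.mk' NN g =
      QuotientGroup.mk' NN (bb * tt⁻¹) ^ i * QuotientGroup.mk' NN tt ^ j by
    obtain ⟨i, j, h⟩ := H
    exact ⟨i, j, by rw [h, ← map_zpow, ← map_zpow, ← map_mul]⟩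
  generalize QuotientGroup.mk' NN = f at *
  have ht : ∃ i j : ℤ, f tt = f (bb * tt⁻¹) ^ i * f tt ^ j := ⟨0, 1, by simp⟩
  have hb : ∃ i j : ℤ, f bb = f (bb * tt⁻¹) ^ i * f tt ^ j := ⟨1, 1, by simp⟩
  have hinv : ∀ g, (∃ i j : ℤ, f g = f (bb * tt⁻¹) ^ i * f tt ^ j) →
      ∃ i j : ℤ, f g⁻¹ = f (bb * tt⁻¹) ^ i * f tt ^ j := by
    rintro g ⟨i, j, h⟩
    obtain ⟨k, hk⟩ := hsw (-j) (-i)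
    exact ⟨k, -j, by rw [← hk, map_inv, h]; group⟩
  have hmul : ∀ g h, (∃ i j : ℤ, f g = f (bb * tt⁻¹) ^ i * f tt ^ j) →
      (∃ i j : ℤ, f h = f (bb * tt⁻¹) ^ i * f tt ^ j) →
      ∃ i j : ℤ, f (g * h) = f (bb * tt⁻¹) ^ i * f tt ^ j := by
    rintro g h ⟨i, j, h1⟩ ⟨i', j', h2⟩
    obtain ⟨k, hk⟩ := hsw j i'
    refine ⟨i + k, j + j', ?_⟩
    rw [map_mul, h1, h2, zpow_add, zpow_add]
    generalize f (bb * tt⁻¹) = y at *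
    generalize f tt = t at *
    calc y ^ i * t ^ j * (y ^ i' * t ^ j') = y ^ i * (t ^ j * y ^ i') * t ^ j' := by group
      _ = _ := by rw [hk]; group
  induction g using PresentedGroup.induction_on with
  | _ z =>
    induction z using FreeGroup.induction_on with
    | C1 => exact ⟨0, 0, by simp⟩
    | of x => fin_cases x; exacts [ht, hb]
    | inv_of x hx => rw [map_inv]; exact hinv _ hx
    | mul x y hx hy => rw [map_mul]; exact hmul _ _ hx hy

/-- the even part -/
private def gg : Multiplicative (ℤ × ZMod 13) →* DihedralGroup 13 × Multiplicative ℤ where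
  toFun x := (.r x.toAdd.2, Multiplicative.ofAdd (2 * x.toAdd.1))
  map_one' := rfl
  map_mul' x y := by
    ext1
    · simp
    · simp [mul_add]

private theorem gg_inj : Function.Injective gg := by
  intro x y h
  have h1 : DihedralGroup.r x.toAdd.2 = DihedralGroup.r y.toAdd.2 := congrArg Prod.fst h
  have h2 : 2 * x.toAdd.1 = 2 * y.toAdd.1 := congrArg (fun z => z.2.toAdd) h
  apply Multiplicative.toAdd.injective
  ext1
  · omega
  · simpa using h1

private theorem range_le (h : Gamma') (hh : h ∈ Gamma'Sq) : psi h ∈ gg.range := by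
  have : Gamma'Sq ≤ gg.range.comap psi := by
    rw [Gamma'Sq, Subgroup.closure_le]
    rintro _ ⟨g, rfl⟩
    change psi (g ^ 2) ∈ gg.range
    rw [map_pow, pow_two]
    rcases psi g with ⟨d, z⟩
    rcases d with i | i
    · exact ⟨Multiplicative.ofAdd (z.toAdd, i + i), by
        ext1
        · simp [gg]
        · simp [gg, two_mul]⟩
    · exact ⟨Multiplicative.ofAdd (z.toAdd, 0), by
        ext1
        · simp [gg]
        · simp [gg, two_mul]⟩
  exact this hh

private theorem range_eq : (psi.comp Gamma'Sq.subtype).range = gg.range := by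
  apply le_antisymm
  · rintro _ ⟨h, rfl⟩
    exact range_le h.1 h.2
  · rintro _ ⟨x, rfl⟩
    obtain ⟨i, hi⟩ := ZMod.intCast_surjective x.toAdd.2
    refine ⟨⟨(bb * tt⁻¹) ^ i * (tt ^ 2) ^ x.toAdd.1,
      mul_mem (zpow_mem y_mem _) (zpow_mem (sq_mem _) _)⟩, ?_⟩
    change psi ((bb * tt⁻¹) ^ i * (tt ^ 2) ^ x.toAdd.1) = _
    have h2 : psi (tt ^ 2) = (1, Multiplicative.ofAdd 2) := by rw [map_pow, psi_tt]; decide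
    rw [map_mul, psi_y_zpow, map_zpow, h2, hi]
    ext1
    · simp [gg]
    · change (1 : Multiplicative ℤ) * (Multiplicative.ofAdd 2) ^ x.toAdd.1 =
        Multiplicative.ofAdd (2 * x.toAdd.1)
      rw [one_mul, ← ofAdd_zsmul, smul_eq_mul, mul_comm]

private theorem NN_le : NN ≤ psi.ker := by
  rw [Subgroup.commutator_le]
  intro g hg h hh
  obtain ⟨x, hx⟩ := range_le g hg
  obtain ⟨y, hy⟩ := range_le h hh
  rw [MonoidHom.mem_ker, map_commutatorElement, ← hx, ← hy, ← map_commutatorElement,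
    commutatorElement_eq_one_iff_mul_comm.2 (mul_comm x y), map_one]

private theorem ker_le : psi.ker ≤ NN := by
  intro g hg
  obtain ⟨i, j, h⟩ := normal_form g
  have hk : psi ((bb * tt⁻¹) ^ i * tt ^ j) = 1 := by
    have := NN_le (QuotientGroup.eq.1 h)
    rw [MonoidHom.mem_ker, map_mul, map_inv, MonoidHom.mem_ker.1 hg] at this
    simpa using this
  rw [map_mul, psi_y_zpow, map_zpow, psi_tt] at hk
  have hj : j = 0 := by
    have := congrArg (fun z => z.2.toAdd) hk
    simpa using this
  subst hj
  have hi : (i : ZMod 13) = 0 := by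
    have := congrArg Prod.fst hk
    simp only [zpow_zero, Prod.fst_mul, Prod.fst_one, mul_one] at this
    rw [DihedralGroup.one_def] at this
    exact DihedralGroup.r.inj this
  obtain ⟨k, rfl⟩ := (ZMod.intCast_zmod_eq_zero_iff_dvd i 13).1 hi
  rw [← QuotientGroup.ker_mk' NN, MonoidHom.mem_ker, h, zpow_zero, mul_one, map_zpow, zpow_mul]
  have := rel_Q.2
  norm_cast
  rw [this, one_zpow]

private theorem ker_eq : commutator Gamma'Sq = (psi.comp Gamma'Sq.subtype).ker := by
  have h : (commutator Gamma'Sq).map Gamma'Sq.subtype = psi.ker := by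
    rw [Subgroup.map_subtype_commutator]
    exact le_antisymm NN_le ker_le
  rw [← MonoidHom.comap_ker, ← h, Subgroup.comap_map_eq_self_of_injective]
  exact Subgroup.subtype_injective _

/-- The abelianization of `Γ'^(2)` is isomorphic to `ℤ × ℤ/13ℤ`. -/
theorem Gamma'Sq_abelianization :
    Nonempty (Abelianization Gamma'Sq ≃* Multiplicative (ℤ × ZMod 13)) := by
  exact ⟨(QuotientGroup.quotientMulEquivOfEq ker_eq).trans
    ((QuotientGroup.quotientKerEquivRange _).trans
      ((MulEquiv.subgroupCongr range_eq).trans (MonoidHom.ofInjective gg_inj).symm))⟩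
end

section
/- For every complex number t₀ satisfying t₀¹² − 3t₀¹⁰ + 5t₀⁸ − 5t₀⁶ + 5t₀⁴ − 3t₀² + 1 = 0, the element s₀ = t₀ + t₀⁻¹ is algebraic over ℚ of degree exactly 6, i.e. the minimal polynomial of s₀ over ℚ has degree 6. -/
theorem no_factor_one : ∀ (a b0 : ZMod 3), 1 = a * b0 →
    0 = a * (-1 - a * (-a * (a * a))) + b0 → False := by
  decide

theorem no_factor_two : ∀ (a c b0 : ZMod 3), 1 = a * b0 →
    0 = a * (-c * (c * c - a) + a * c) + c * b0 →
    -1 = a * (c * c - a) + c * (-c * (c * c - a) + a * c) + b0 → False := by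
  decide

theorem no_factor_three : ∀ (a c d b0 : ZMod 3), 1 = a * b0 →
    0 = a * (d * d - c) + c * b0 →
    -1 = a * -d + c * (d * d - c) + d * b0 →
    0 = a + c * -d + d * (d * d - c) + b0 → False := by
  decide

open Polynomial in
/-- The reduction modulo 3 of the degree six polynomial is irreducible. -/
theorem irred_mod_three : Irreducible (X ^ 6 - X ^ 2 + 1 : (ZMod 3)[X]) := by
  have : Fact (Nat.Prime 3) := ⟨by norm_num⟩
  have hdeg : (X ^ 6 - X ^ 2 + 1 : (ZMod 3)[X]).natDegree = 6 := by compute_degree!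
  have hmon : (X ^ 6 - X ^ 2 + 1 : (ZMod 3)[X]).Monic := by monicity!
  rw [hmon.irreducible_iff_lt_natDegree_lt (by intro h; rw [h] at hdeg; simp at hdeg)]
  rintro g hg hgd ⟨k, hk⟩
  have hkm : k.Monic := hg.of_mul_monic_left (hk ▸ hmon)
  have hsum : g.natDegree + k.natDegree = 6 := by
    rw [← hg.natDegree_mul hkm, ← hk, hdeg]
  rw [hdeg, Finset.mem_Ioc] at hgd
  have hg1 := hg.coeff_natDegree
  have hk1 := hkm.coeff_natDegree
  have hg0 : ∀ n, g.natDegree < n → g.coeff n = 0 := fun n h => coeff_eq_zero_of_natDegree_lt h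
  have hk0 : ∀ n, k.natDegree < n → k.coeff n = 0 := fun n h => coeff_eq_zero_of_natDegree_lt h
  have e := fun n => congrArg (fun p => coeff p n) hk
  simp only [coeff_mul, Finset.Nat.sum_antidiagonal_eq_sum_range_succ_mk, coeff_add, coeff_sub,
    coeff_X_pow, coeff_one] at e
  have e0 := e 0
  have e1 := e 1
  have e2 := e 2
  have e3 := e 3
  have e4 := e 4
  have e5 := e 5
  clear e
  have hd : g.natDegree = 1 ∨ g.natDegree = 2 ∨ g.natDegree = 3 := by omega
  rcases hd with hd | hd | hd
  · have hkd : k.natDegree = 5 := by omega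
    rw [hd] at hg1 hg0
    rw [hkd] at hk1 hk0
    simp [Finset.sum_range_succ, hg1, hk1, hg0 2, hg0 3, hg0 4, hg0 5] at e0 e1 e2 e3 e4 e5
    generalize g.coeff 0 = a at *
    generalize k.coeff 0 = b0 at *
    generalize k.coeff 1 = b1 at *
    generalize k.coeff 2 = b2 at *
    generalize k.coeff 3 = b3 at *
    generalize k.coeff 4 = b4 at *
    clear hg0 hk0 hg1 hk1
    have h4 : b4 = -a := by linear_combination -e5
    subst h4
    have h3 : b3 = a * a := by linear_combination -e4
    subst h3
    have h2 : b2 = -a * (a * a) := by linear_combination -e3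
    subst h2
    have h1 : b1 = -1 - a * (-a * (a * a)) := by linear_combination -e2
    subst h1
    clear e5 e4 e3 e2 hk hsum hdeg hmon hgd hd hkd hg hkm
    revert a b0
    exact no_factor_one
  · have hkd : k.natDegree = 4 := by omega
    rw [hd] at hg1 hg0
    rw [hkd] at hk1 hk0
    simp [Finset.sum_range_succ, hg1, hk1, hg0 3, hg0 4, hg0 5, hk0 5] at e0 e1 e2 e3 e4 e5
    generalize g.coeff 0 = a at *
    generalize g.coeff 1 = c at *
    generalize k.coeff 0 = b0 at *
    generalize k.coeff 1 = b1 at *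
    generalize k.coeff 2 = b2 at *
    generalize k.coeff 3 = b3 at *
    clear hg0 hk0 hg1 hk1
    have h3 : b3 = -c := by linear_combination -e5
    subst h3
    have h2 : b2 = c * c - a := by linear_combination -e4
    subst h2
    have h1 : b1 = -c * (c * c - a) + a * c := by linear_combination -e3
    subst h1
    clear e5 e4 e3 hk hsum hdeg hmon hgd hd hkd hg hkm
    revert a c b0
    exact no_factor_two
  · have hkd : k.natDegree = 3 := by omega
    rw [hd] at hg1 hg0
    rw [hkd] at hk1 hk0
    simp [Finset.sum_range_succ, hg1, hk1, hg0 4, hg0 5, hk0 4, hk0 5] at e0 e1 e2 e3 e4 e5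
    generalize g.coeff 0 = a at *
    generalize g.coeff 1 = c at *
    generalize g.coeff 2 = d at *
    generalize k.coeff 0 = b0 at *
    generalize k.coeff 1 = b1 at *
    generalize k.coeff 2 = b2 at *
    clear hg0 hk0 hg1 hk1
    have h2 : b2 = -d := by linear_combination -e5
    subst h2
    have h1 : b1 = d * d - c := by linear_combination -e4
    subst h1
    clear e5 e4 hk hsum hdeg hmon hgd hd hkd hg hkm
    revert a c d b0
    exact no_factor_three

open Polynomial in
/-- The degree six polynomial satisfied by the trace is irreducible over the rationals. -/
theorem irred_rat : Irreducible (X ^ 6 - 9 * X ^ 4 + 26 * X ^ 2 - 23 : ℚ[X]) := by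
  have : Fact (Nat.Prime 3) := ⟨by norm_num⟩
  have hmon : (X ^ 6 - 9 * X ^ 4 + 26 * X ^ 2 - 23 : ℤ[X]).Monic := by monicity!
  have h1 : Irreducible (X ^ 6 - 9 * X ^ 4 + 26 * X ^ 2 - 23 : ℤ[X]) := by
    refine hmon.irreducible_of_irreducible_map (Int.castRingHom (ZMod 3)) _ ?_
    convert irred_mod_three using 1
    have h3 : (3 : (ZMod 3)[X]) = 0 := by
      have : ((3 : ℕ) : (ZMod 3)[X]) = 0 := CharP.cast_eq_zero _ 3
      exact_mod_cast this
    simp only [Polynomial.map_sub, Polynomial.map_add, Polynomial.map_mul, Polynomial.map_pow,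
      map_X, Polynomial.map_ofNat]
    linear_combination (-3 * X ^ 4 + 9 * X ^ 2 - 8) * h3
  have h2 := (hmon.irreducible_iff_irreducible_map_fraction_map (K := ℚ)).1 h1
  simpa using h2

open Polynomial in
/-- For any root `t₀` of `t¹² − 3t¹⁰ + 5t⁸ − 5t⁶ + 5t⁴ − 3t² + 1`, the element
`t₀ + t₀⁻¹` is algebraic over `ℚ` of degree exactly 6. -/
theorem core_eigenvalue_trace_degree_six (t₀ : ℂ)
    (h : t₀ ^ 12 - 3 * t₀ ^ 10 + 5 * t₀ ^ 8 - 5 * t₀ ^ 6 + 5 * t₀ ^ 4 - 3 * t₀ ^ 2 + 1 = 0) :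
    IsAlgebraic ℚ (t₀ + t₀⁻¹) ∧ (minpoly ℚ (t₀ + t₀⁻¹)).natDegree = 6 := by
  have ht : t₀ ≠ 0 := by
    rintro rfl
    norm_num at h
  have hmon : (X ^ 6 - 9 * X ^ 4 + 26 * X ^ 2 - 23 : ℚ[X]).Monic := by monicity!
  have hdeg : (X ^ 6 - 9 * X ^ 4 + 26 * X ^ 2 - 23 : ℚ[X]).natDegree = 6 := by compute_degree!
  have hroot : aeval (t₀ + t₀⁻¹) (X ^ 6 - 9 * X ^ 4 + 26 * X ^ 2 - 23 : ℚ[X]) = 0 := by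
    simp only [map_sub, map_add, map_mul, map_pow, aeval_X, map_ofNat]
    field_simp
    linear_combination h
  refine ⟨⟨_, hmon.ne_zero, hroot⟩, ?_⟩
  rw [← minpoly.eq_of_irreducible_of_monic irred_rat hroot hmon, hdeg]
end

section
/- The presented group Γ¹_𝒪 = ⟨a, b ∣ a³, a·b⁻¹·a·b²·a⁻¹·b⁻²·a⁻¹·b²⟩ has exactly two normal subgroups K such that the quotient Γ¹_𝒪/K is isomorphic to PSL(2, 23). -/
open scoped MatrixGroups

/-- `Γ¹_𝒪 = ⟨a, b ∣ a³, a·b⁻¹·a·b²·a⁻¹·b⁻²·a⁻¹·b²⟩`, the orbifold fundamental group of the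
`(3,0)` Dehn filling on the knot 5₂. -/
private abbrev GammaO : Type :=
  PresentedGroup
    ({a ^ 3, a * b⁻¹ * a * b ^ 2 * a⁻¹ * b⁻¹ ^ 2 * a⁻¹ * b ^ 2} : Set (FreeGroup (Fin 2)))

namespace GammaProof

instance fact23 : Fact (Nat.Prime 23) := ⟨by norm_num⟩

/-- `SL(2, 23)`. -/
abbrev S : Type := Matrix.SpecialLinearGroup (Fin 2) (ZMod 23)

/-- The image of the first generator. -/
def C : S := ⟨!![0, -1; 1, -1], by decide +kernel⟩
/-- Its inverse. -/
def C' : S := ⟨!![-1, 1; -1, 0], by decide +kernel⟩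
/-- The image of the second generator, first representation. -/
def B1 : S := ⟨!![0, 1; -1, 3], by decide +kernel⟩
/-- Its inverse. -/
def B1' : S := ⟨!![3, -1; 1, 0], by decide +kernel⟩
/-- The image of the second generator, second representation. -/
def B2 : S := ⟨!![0, 11; 2, 10], by decide +kernel⟩
/-- Its inverse. -/
def B2' : S := ⟨!![10, -11; -2, 0], by decide +kernel⟩
/-- Upper transvection. -/
def U (x : ZMod 23) : S := ⟨!![1, x; 0, 1], by simp [Matrix.det_fin_two]⟩
/-- Lower transvection. -/
def L (x : ZMod 23) : S := ⟨!![1, 0; x, 1], by simp [Matrix.det_fin_two]⟩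

theorem U_coe (x : ZMod 23) : (U x : Matrix (Fin 2) (Fin 2) (ZMod 23)) = !![1, x; 0, 1] := rfl
theorem L_coe (x : ZMod 23) : (L x : Matrix (Fin 2) (Fin 2) (ZMod 23)) = !![1, 0; x, 1] := rfl

theorem C_inv : C⁻¹ = C' := inv_eq_of_mul_eq_one_right (by decide +kernel)
theorem B1_inv : B1⁻¹ = B1' := inv_eq_of_mul_eq_one_right (by decide +kernel)
theorem B2_inv : B2⁻¹ = B2' := inv_eq_of_mul_eq_one_right (by decide +kernel)

theorem U_pow (n : ℕ) : U 1 ^ n = U n := by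
  induction n with
  | zero => ext i j; fin_cases i <;> fin_cases j <;> simp [U_coe]
  | succ n ih =>
    rw [pow_succ, ih]
    ext i j; fin_cases i <;> fin_cases j <;> simp [U_coe, Matrix.mul_apply, Fin.sum_univ_succ, add_comm]

theorem L_pow (n : ℕ) : L 1 ^ n = L n := by
  induction n with
  | zero => ext i j; fin_cases i <;> fin_cases j <;> simp [L_coe]
  | succ n ih =>
    rw [pow_succ, ih]
    ext i j; fin_cases i <;> fin_cases j <;> simp [L_coe, Matrix.mul_apply, Fin.sum_univ_succ, add_comm]

theorem gen_aux (H : Subgroup S) (hU : U 1 ∈ H) (hL : L 1 ∈ H) (M : S) (h : M 1 0 ≠ 0) : M ∈ H := by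
  have hUx : ∀ x, U x ∈ H := fun x => by
    have := H.pow_mem hU x.val
    rwa [U_pow, ZMod.natCast_zmod_val] at this
  have hLx : ∀ x, L x ∈ H := fun x => by
    have := H.pow_mem hL x.val
    rwa [L_pow, ZMod.natCast_zmod_val] at this
  have hd := M.det_coe
  rw [Matrix.det_fin_two] at hd
  have key : M = U ((M 0 0 - 1) / M 1 0) * L (M 1 0) * U ((M 1 1 - 1) / M 1 0) := by
    ext i j
    fin_cases i <;> fin_cases j <;>
      simp [U_coe, L_coe, Matrix.mul_apply, Fin.sum_univ_succ] <;> field_simp <;> grind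
  rw [key]
  exact H.mul_mem (H.mul_mem (hUx _) (hLx _)) (hUx _)

theorem gen (H : Subgroup S) (hU : U 1 ∈ H) (hL : L 1 ∈ H) : H = ⊤ := by
  rw [eq_top_iff]
  intro M _
  by_cases h : M 1 0 = 0
  · have hd := M.det_coe
    rw [Matrix.det_fin_two] at hd
    have h2 : L 1 * M ∈ H := by
      apply gen_aux H hU hL
      simp [L_coe, Matrix.mul_apply, Fin.sum_univ_succ, h]
      rintro h0
      simp [h, h0] at hd
    exact (H.mul_mem_cancel_left hL).1 h2
  · exact gen_aux H hU hL M h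

theorem center_iff (M : S) : M ∈ Subgroup.center S ↔ M = 1 ∨ M = -1 := by
  constructor
  · intro h
    rw [Subgroup.mem_center_iff] at h
    have h1 := congrArg (fun X : S => (X : Matrix (Fin 2) (Fin 2) (ZMod 23))) (h (U 1))
    have h2 := congrArg (fun X : S => (X : Matrix (Fin 2) (Fin 2) (ZMod 23))) (h (L 1))
    have h101 := congrFun (congrFun h1 0) 1
    have h100 := congrFun (congrFun h1 0) 0
    have h200 := congrFun (congrFun h2 0) 0
    simp [U_coe, L_coe, Matrix.mul_apply, Fin.sum_univ_succ] at h101 h100 h200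
    have hd := M.det_coe
    rw [Matrix.det_fin_two] at hd
    have e : M 1 1 = M 0 0 := by grind
    rw [h100, h200, e] at hd
    have hd' : M 0 0 * M 0 0 = 1 := by grind
    rcases mul_self_eq_one_iff.1 hd' with h0 | h0
    · left; ext i j; fin_cases i <;> fin_cases j <;> simp [*]
    · right; ext i j; fin_cases i <;> fin_cases j <;> simp [*]
  · rintro (rfl | rfl)
    · exact one_mem _
    · rw [Subgroup.mem_center_iff]; intro g; simp

/-- The projection to `PSL`. -/
abbrev pr : S →* PSL(2, ZMod 23) := QuotientGroup.mk' (Subgroup.center S)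

theorem pr_one_iff (M : S) : pr M = 1 ↔ M = 1 ∨ M = -1 := by
  rw [← center_iff]; exact QuotientGroup.eq_one_iff M

/-- The word of the second relator. -/
def rel {G : Type*} [Group G] (x y : G) : G :=
  x * y⁻¹ * x * y ^ 2 * x⁻¹ * y⁻¹ ^ 2 * x⁻¹ * y ^ 2

theorem rel_map {G H : Type*} [Group G] [Group H] (f : G →* H) (x y : G) :
    f (rel x y) = rel (f x) (f y) := by simp [rel]

theorem rel_eq1 {G : Type*} [Group G] (x y : G) (hr : rel x y = 1) :
    y * y * x * y⁻¹ * x * y * y = x * y * y * x := by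
  have h1 : x * y⁻¹ * x * y ^ 2 = (x⁻¹ * y⁻¹ ^ 2 * x⁻¹ * y ^ 2)⁻¹ := by
    apply eq_inv_of_mul_eq_one_left
    rw [← hr, rel]; simp only [mul_assoc]
  have h4 : x * y⁻¹ * x * y ^ 2 = y⁻¹ ^ 2 * x * y ^ 2 * x := by
    rw [h1]; simp [mul_assoc]
  have h5 : y * y * x * y⁻¹ * x * y * y = y * y * (x * y⁻¹ * x * y ^ 2) := by
    simp [pow_two, mul_assoc]
  rw [h5, h4]; simp [pow_two, mul_assoc]

theorem rel_eq2 {G : Type*} [Group G] (x y : G) (hr : rel x y = 1) :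
    y * x = (y⁻¹ * x * y * y) * x * (y⁻¹ * x * y * y)⁻¹ := by
  rw [eq_mul_inv_iff_mul_eq]
  have : y * x * (y⁻¹ * x * y * y) = y⁻¹ * (y * y * x * y⁻¹ * x * y * y) := by
    simp [mul_assoc]
  rw [this, rel_eq1 x y hr]; simp [mul_assoc]

theorem enum1 : ∀ p r s : ZMod 23, p + s = 3 → p * s - (r + s - 1) * r = 1 →
    ∃ x y : ZMod 23, x * (x - y) + y * y ≠ 0 ∧ x * p - y * r = y ∧ x * (r + s - 1) - y * s = x - y ∧
      y * p + (x - y) * r = -x + 3 * y ∧ y * (r + s - 1) + (x - y) * s = y + 3 * (x - y) := by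
  decide +kernel

theorem enum2 : ∀ p r s : ZMod 23, p + s = 10 → p * s - (r + s - 1) * r = 1 →
    ∃ x y : ZMod 23, x * (x - y) + y * y ≠ 0 ∧ x * p - y * r = 11 * y ∧
      x * (r + s - 1) - y * s = 11 * (x - y) ∧
      y * p + (x - y) * r = 2 * x + 10 * y ∧
      y * (r + s - 1) + (x - y) * s = - (2 * y) + 10 * (x - y) := by
  decide +kernel

theorem enum0 : ∀ t : ZMod 23, t ^ 3 = t + 1 → t = 3 ∨ t = 10 := by decide +kernel

theorem cube_root : ∀ x : ZMod 23, x ^ 3 = 1 → x = 1 := by decide +kernel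

/-- Ambient matrices. -/
abbrev Mat : Type := Matrix (Fin 2) (Fin 2) (ZMod 23)

/-- Classification of pairs whose first member is the companion matrix. -/
theorem classify (B B' : Mat) (hd : B.det = 1) (hB : B * B' = 1)
    (htr : (B * C.1).trace = -1)
    (h : B * B * C.1 * B' * C.1 * B * B = C.1 * B * B * C.1) :
    B = 1 ∨ ∃ P : Mat, P.det ≠ 0 ∧ P * C.1 = C.1 * P ∧ (P * B = B1.1 * P ∨ P * B = B2.1 * P) := by
  have hC : C.1 = !![0, -1; 1, -1] := rfl
  have hB1 : B1.1 = !![0, 1; -1, 3] := rfl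
  have hB2 : B2.1 = !![0, 11; 2, 10] := rfl
  have hB' : B' = B.adjugate := by
    have h1 : B.adjugate * B = 1 := by rw [Matrix.adjugate_mul, hd, one_smul]
    calc B' = (B.adjugate * B) * B' := by rw [h1, one_mul]
      _ = B.adjugate := by rw [mul_assoc, hB, mul_one]
  subst hB'
  obtain ⟨p, q, r, s, rfl⟩ : ∃ p q r s, B = !![p, q; r, s] :=
    ⟨_, _, _, _, Matrix.eta_fin_two B⟩
  rw [hC] at h htr
  rw [hC, hB1, hB2]
  clear hC hB1 hB2 hB
  rw [Matrix.adjugate_fin_two_of] at h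
  rw [Matrix.det_fin_two_of] at hd
  simp [Matrix.trace_fin_two, Matrix.mul_apply, Fin.sum_univ_succ] at htr
  have hq : q = r + s - 1 := by grind
  subst hq
  have h00 := congrFun (congrFun h 0) 0
  have h01 := congrFun (congrFun h 0) 1
  have h10 := congrFun (congrFun h 1) 0
  have h11 := congrFun (congrFun h 1) 1
  clear h
  simp [Matrix.mul_apply, Fin.sum_univ_succ] at h00 h01 h10 h11
  by_cases hsc : r = 0 ∧ r + s - 1 = 0
  · left
    obtain ⟨hr, hq⟩ := hsc
    have hs : s = 1 := by grind
    have hp : p = 1 := by grind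
    subst hr hs hp
    ext i j; fin_cases i <;> fin_cases j <;> simp
  · right
    have e1 : r * ((p + s) ^ 3 - (p + s) - 1) = 0 := by grind
    have e2 : (r + s - 1) * ((p + s) ^ 3 - (p + s) - 1) = 0 := by grind
    have e2 : (p + s) ^ 3 = (p + s) + 1 := by
      rcases mul_eq_zero.1 e1 with h | h
      · rcases mul_eq_zero.1 e2 with h' | h'
        · exact absurd ⟨h, h'⟩ hsc
        · linear_combination h'
      · linear_combination h
    clear h00 h01 h10 h11
    rcases enum0 _ e2 with ht | ht
    · obtain ⟨x, y, hxy, k1, k2, k3, k4⟩ := enum1 p r s ht hd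
      refine ⟨!![x, -y; y, x - y], ?_, ?_, Or.inl ?_⟩
      · rw [Matrix.det_fin_two_of]; intro h0; apply hxy; linear_combination h0
      · ext i j; fin_cases i <;> fin_cases j <;> simp [Matrix.mul_apply, Fin.sum_univ_succ] <;> ring
      · ext i j; fin_cases i <;> fin_cases j <;> simp [Matrix.mul_apply, Fin.sum_univ_succ]
        · linear_combination k1
        · linear_combination k2
        · linear_combination k3
        · linear_combination k4
    · obtain ⟨x, y, hxy, k1, k2, k3, k4⟩ := enum2 p r s ht hd
      refine ⟨!![x, -y; y, x - y], ?_, ?_, Or.inr ?_⟩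
      · rw [Matrix.det_fin_two_of]; intro h0; apply hxy; linear_combination h0
      · ext i j; fin_cases i <;> fin_cases j <;> simp [Matrix.mul_apply, Fin.sum_univ_succ] <;> ring
      · ext i j; fin_cases i <;> fin_cases j <;> simp [Matrix.mul_apply, Fin.sum_univ_succ]
        · linear_combination k1
        · linear_combination k2
        · linear_combination k3
        · linear_combination k4

/-- An element of order three is conjugate to the companion matrix. -/
theorem companion (A : S) (h3 : A ^ 3 = 1) (h1 : A ≠ 1) :
    ∃ Q : Mat, Q.det ≠ 0 ∧ A.1 * Q = Q * C.1 := by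
  have hd := A.2
  have h3' : A.1 * A.1 * A.1 = 1 := by
    have := congrArg (fun X : S => (X : Mat)) h3
    simpa [pow_succ] using this
  have h1' : A.1 ≠ 1 := fun h => h1 (Subtype.ext h)
  generalize A.1 = M at *
  have hC : C.1 = !![0, -1; 1, -1] := rfl
  rw [hC]
  obtain ⟨p, q, r, s, rfl⟩ : ∃ p q r s, M = !![p, q; r, s] :=
    ⟨_, _, _, _, Matrix.eta_fin_two M⟩
  rw [Matrix.det_fin_two_of] at hd
  have h00 := congrFun (congrFun h3' 0) 0
  have h01 := congrFun (congrFun h3' 0) 1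
  have h10 := congrFun (congrFun h3' 1) 0
  have h11 := congrFun (congrFun h3' 1) 1
  simp [Matrix.mul_apply, Fin.sum_univ_succ] at h00 h01 h10 h11
  clear h3'
  by_cases hr : r = 0
  · exfalso
    subst hr
    have hp : p = 1 := cube_root p (by grind)
    have hs : s = 1 := cube_root s (by grind)
    subst hp hs
    have h3q : (3 : ZMod 23) * q = 0 := by grind
    have hq : q = 0 := by
      rcases mul_eq_zero.1 h3q with h | h
      · exact absurd h (by decide +kernel)
      · exact h
    subst hq
    apply h1'
    ext i j; fin_cases i <;> fin_cases j <;> simp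
  · have e1 : r * ((p + s - 1) * (p + s + 1)) = 0 := by grind
    have ht : p + s = -1 := by
      rcases mul_eq_zero.1 e1 with h | h
      · exact absurd h hr
      rcases mul_eq_zero.1 h with h | h
      · exfalso
        have hs : s = 1 - p := by linear_combination h
        subst hs
        have : (2 : ZMod 23) = 0 := by grind
        exact absurd this (by decide +kernel)
      · linear_combination h
    have hs : s = -1 - p := by linear_combination ht
    subst hs
    refine ⟨!![1, p; 0, r], ?_, ?_⟩
    · rw [Matrix.det_fin_two_of]; simpa using hr
    · ext i j; fin_cases i <;> fin_cases j <;> simp [Matrix.mul_apply, Fin.sum_univ_succ] <;> grind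

end GammaProof

open GammaProof

private def gmk {G : Type*} [Group G] (x y : G) (hx : x ^ 3 = 1) (hr : rel x y = 1) : GammaO →* G :=
  PresentedGroup.toGroup (f := ![x, y]) (by
    rintro w (rfl | rfl)
    · simpa [a] using hx
    · simpa [a, b, rel] using hr)

private def ga : GammaO := PresentedGroup.of 0
private def gb : GammaO := PresentedGroup.of 1

private theorem ga3 : ga ^ 3 = 1 := by
  have := PresentedGroup.one_of_mem (rels := ({a ^ 3, a * b⁻¹ * a * b ^ 2 * a⁻¹ * b⁻¹ ^ 2 * a⁻¹ * b ^ 2} : Set (FreeGroup (Fin 2)))) (x := a ^ 3) (by simp)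
  exact this

private theorem grel : rel ga gb = 1 := by
  have := PresentedGroup.one_of_mem (rels := ({a ^ 3, a * b⁻¹ * a * b ^ 2 * a⁻¹ * b⁻¹ ^ 2 * a⁻¹ * b ^ 2} : Set (FreeGroup (Fin 2)))) (x := a * b⁻¹ * a * b ^ 2 * a⁻¹ * b⁻¹ ^ 2 * a⁻¹ * b ^ 2) (by simp)
  exact this

private theorem gmk_a {G : Type*} [Group G] (x y : G) (hx hr) : gmk x y hx hr ga = x := by
  simp [gmk, ga]

private theorem gmk_b {G : Type*} [Group G] (x y : G) (hx hr) : gmk x y hx hr gb = y := by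
  simp [gmk, gb]

private theorem g_ext {G : Type*} [Group G] (f g : GammaO →* G) (h1 : f ga = g ga) (h2 : f gb = g gb) :
    f = g := by
  apply PresentedGroup.ext
  intro i
  fin_cases i
  · exact h1
  · exact h2

private def psi1 : GammaO →* S := gmk C B1 (by decide +kernel)
  (by simp only [rel, C_inv, B1_inv]; decide +kernel)
private def psi2 : GammaO →* S := gmk C B2 (by decide +kernel)
  (by simp only [rel, C_inv, B2_inv]; decide +kernel)

private theorem psi1_a : psi1 ga = C := gmk_a ..
private theorem psi1_b : psi1 gb = B1 := gmk_b ..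
private theorem psi2_a : psi2 ga = C := gmk_a ..
private theorem psi2_b : psi2 gb = B2 := gmk_b ..

private theorem surj_of (ψ : GammaO →* S) (u v : GammaO) (hu : ψ u = U 1) (hv : ψ v = L 1) :
    Function.Surjective (pr.comp ψ) := by
  have : Function.Surjective ψ := MonoidHom.range_eq_top.1 (gen _ ⟨u, hu⟩ ⟨v, hv⟩)
  exact (QuotientGroup.mk'_surjective _).comp this

private theorem surj1 : Function.Surjective (pr.comp psi1) := by
  apply surj_of psi1 (gb * gb * ga⁻¹ * gb * gb * gb * ga⁻¹ * gb * gb * ga⁻¹ * gb⁻¹)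
    (gb⁻¹ * gb⁻¹ * ga * gb⁻¹ * gb⁻¹ * gb⁻¹ * ga * gb⁻¹ * gb⁻¹ * ga * gb)
  · simp only [map_mul, map_inv, psi1_a, psi1_b, C_inv, B1_inv]; decide +kernel
  · simp only [map_mul, map_inv, psi1_a, psi1_b, C_inv, B1_inv]; decide +kernel

private theorem surj2 : Function.Surjective (pr.comp psi2) := by
  apply surj_of psi2 (gb⁻¹ * gb⁻¹ * ga * gb⁻¹ * ga⁻¹ * gb * ga * gb⁻¹ * ga)
    (gb * ga⁻¹ * gb⁻¹ * ga * gb * ga⁻¹ * gb * gb * ga⁻¹)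
  · simp only [map_mul, map_inv, psi2_a, psi2_b, C_inv, B2_inv]; decide +kernel
  · simp only [map_mul, map_inv, psi2_a, psi2_b, C_inv, B2_inv]; decide +kernel

private theorem ker_ne : (pr.comp psi1).ker ≠ (pr.comp psi2).ker := by
  intro h
  have h2 : gb ^ 11 ∈ (pr.comp psi2).ker := by
    rw [MonoidHom.mem_ker, MonoidHom.comp_apply, pr_one_iff, map_pow, psi2_b]
    decide +kernel
  rw [← h, MonoidHom.mem_ker, MonoidHom.comp_apply, pr_one_iff, map_pow, psi1_b] at h2
  revert h2
  decide +kernel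

private theorem not_cyclic (φ : GammaO →* PSL(2, ZMod 23)) (hφ : Function.Surjective φ)
    (x : PSL(2, ZMod 23)) (h1 : φ ga ∈ Subgroup.zpowers x) (h2 : φ gb ∈ Subgroup.zpowers x) :
    False := by
  have key : ∀ y, y ∈ Subgroup.zpowers x := by
    have : (⊤ : Subgroup GammaO) ≤ (Subgroup.zpowers x).comap φ := by
      rw [← PresentedGroup.closure_range_of, Subgroup.closure_le]
      rintro _ ⟨i, rfl⟩
      fin_cases i
      · exact h1
      · exact h2
    intro y
    obtain ⟨g, rfl⟩ := hφ y
    exact this (Subgroup.mem_top g)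
  obtain ⟨m, hm⟩ := key (pr (U 1))
  obtain ⟨n, hn⟩ := key (pr (L 1))
  have hc : pr (U 1) * pr (L 1) = pr (L 1) * pr (U 1) := by
    rw [← hm, ← hn]; simp only [← zpow_add, add_comm]
  have hu : (U 1)⁻¹ = U (-1) := inv_eq_of_mul_eq_one_right (by decide +kernel)
  have hl : (L 1)⁻¹ = L (-1) := inv_eq_of_mul_eq_one_right (by decide +kernel)
  have h3 : pr (U 1 * L 1 * (U 1)⁻¹ * (L 1)⁻¹) = 1 := by
    simp only [map_mul, map_inv, hc]; group
  rw [pr_one_iff, hu, hl] at h3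
  revert h3
  decide +kernel

private theorem ker_eq_s9 (ψ ψ' : GammaO →* S) (Q : GL (Fin 2) (ZMod 23))
    (ha : Q * (ψ ga : GL (Fin 2) (ZMod 23)) = (ψ' ga : GL (Fin 2) (ZMod 23)) * Q)
    (hb : Q * (ψ gb : GL (Fin 2) (ZMod 23)) = (ψ' gb : GL (Fin 2) (ZMod 23)) * Q) :
    (pr.comp ψ).ker = (pr.comp ψ').ker := by
  have key : (MulAut.conj Q).toMonoidHom.comp (Matrix.SpecialLinearGroup.toGL.comp ψ)
      = Matrix.SpecialLinearGroup.toGL.comp ψ' := by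
    apply g_ext
    · exact mul_inv_eq_of_eq_mul ha
    · exact mul_inv_eq_of_eq_mul hb
  have key2 : ∀ g, Q.1 * (ψ g).1 = (ψ' g).1 * Q.1 := fun g => by
    have h : Q * Matrix.SpecialLinearGroup.toGL (ψ g) * Q⁻¹
      = Matrix.SpecialLinearGroup.toGL (ψ' g) := DFunLike.congr_fun key g
    exact congrArg Units.val (mul_inv_eq_iff_eq_mul.1 h)
  ext g
  rw [MonoidHom.mem_ker, MonoidHom.mem_ker, MonoidHom.comp_apply, MonoidHom.comp_apply,
    pr_one_iff, pr_one_iff]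
  have k := key2 g
  have c1 : ∀ X Y : Mat, Q.1 * X = Q.1 * Y → X = Y := fun X Y h => by
    simpa [← mul_assoc] using congrArg (fun Z => Q⁻¹.1 * Z) h
  have c2 : ∀ X Y : Mat, X * Q.1 = Y * Q.1 → X = Y := fun X Y h => by
    simpa [mul_assoc] using congrArg (fun Z => Z * Q⁻¹.1) h
  have one_v : (1 : S).1 = 1 := rfl
  have neg_v : (-1 : S).1 = -1 := by simp
  constructor
  · rintro (h | h) <;> rw [h] at k
    · left; apply Subtype.ext; apply c2; rw [← k, one_v]; simp
    · right; apply Subtype.ext; apply c2; rw [← k, neg_v]; simp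
  · rintro (h | h) <;> rw [h] at k
    · left; apply Subtype.ext; apply c1; rw [k, one_v]; simp
    · right; apply Subtype.ext; apply c1; rw [k, neg_v]; simp

private theorem main_conj (ψ : GammaO →* S) (hs : Function.Surjective (pr.comp ψ)) :
    (pr.comp ψ).ker = (pr.comp psi1).ker ∨ (pr.comp ψ).ker = (pr.comp psi2).ker := by
  have hA : ψ ga ≠ 1 := fun h => not_cyclic _ hs (pr (ψ gb)) (by simp [h]) (by simp)
  have hB : ψ gb ≠ 1 := fun h => not_cyclic _ hs (pr (ψ ga)) (by simp) (by simp [h])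
  have h3 : ψ ga ^ 3 = 1 := by rw [← map_pow, ga3, map_one]
  have hrel : rel (ψ ga) (ψ gb) = 1 := by rw [← rel_map, grel, map_one]
  obtain ⟨Q0, hQd, hQ⟩ := companion _ h3 hA
  let Q : GL (Fin 2) (ZMod 23) := Matrix.GeneralLinearGroup.mkOfDetNeZero Q0 hQd
  let ρ : GammaO →* GL (Fin 2) (ZMod 23) :=
    (MulAut.conj Q⁻¹).toMonoidHom.comp (Matrix.SpecialLinearGroup.toGL.comp ψ)
  have hρ : ∀ g, ρ g = Q⁻¹ * Matrix.SpecialLinearGroup.toGL (ψ g) * Q := fun g => by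
    change Q⁻¹ * Matrix.SpecialLinearGroup.toGL (ψ g) * Q⁻¹⁻¹ = _
    rw [inv_inv]
  have hρa : ρ ga = Matrix.SpecialLinearGroup.toGL C := by
    rw [hρ, mul_assoc, inv_mul_eq_iff_eq_mul]
    exact Units.ext hQ
  have hr : rel (ρ ga) (ρ gb) = 1 := by rw [← rel_map, grel, map_one]
  have hr1 : ρ gb * ρ gb * ρ ga * (ρ gb)⁻¹ * ρ ga * ρ gb * ρ gb = ρ ga * ρ gb * ρ gb * ρ ga := rel_eq1 _ _ hr
  have hdet : (ρ gb).1.det = 1 := by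
    rw [hρ]
    have : (Q⁻¹ * Matrix.SpecialLinearGroup.toGL (ψ gb) * Q).1
        = Q⁻¹.1 * (ψ gb).1 * Q.1 := rfl
    rw [this, Matrix.det_mul, Matrix.det_mul, (ψ gb).2, mul_one, ← Matrix.det_mul]
    simp
  have htr : ((ρ gb).1 * C.1).trace = -1 := by
    have h1 := rel_eq2 _ _ hr
    have h2 : (ρ gb).1 * C.1 = (ρ gb * ρ ga).1 := by rw [hρa]; rfl
    rw [h2, h1, Units.val_mul, Units.val_mul, Matrix.trace_units_conj, hρa]
    change C.1.trace = -1
    decide +kernel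
  have hcl := classify (ρ gb).1 (ρ gb)⁻¹.1 hdet (by simp) htr (by
    have := congrArg Units.val hr1
    rw [hρa] at this
    exact this)
  rcases hcl with h | ⟨P0, hPd, hPC, hP⟩
  · exfalso
    have h1 : ρ gb = 1 := Units.ext h
    rw [hρ] at h1
    have h2 : Matrix.SpecialLinearGroup.toGL (ψ gb) = 1 := by
      have : Matrix.SpecialLinearGroup.toGL (ψ gb)
        = Q * (Q⁻¹ * Matrix.SpecialLinearGroup.toGL (ψ gb) * Q) * Q⁻¹ := by
        simp [mul_assoc]
      rw [this, h1]; simp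
    exact hB (Subtype.ext (congrArg Units.val h2))
  · let P : GL (Fin 2) (ZMod 23) := Matrix.GeneralLinearGroup.mkOfDetNeZero P0 hPd
    have cvt : ∀ (g : GammaO) (X : S), P * ρ g = Matrix.SpecialLinearGroup.toGL X * P →
        (P * Q⁻¹) * Matrix.SpecialLinearGroup.toGL (ψ g)
          = Matrix.SpecialLinearGroup.toGL X * (P * Q⁻¹) := fun g X h => by
      rw [hρ] at h
      rw [← mul_assoc, ← h]; simp [mul_assoc]
    have pa : P * ρ ga = Matrix.SpecialLinearGroup.toGL C * P := by
      rw [hρa]; exact Units.ext hPC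
    rcases hP with hP | hP
    · left
      refine ker_eq_s9 ψ psi1 (P * Q⁻¹) ?_ ?_
      · rw [psi1_a]; exact cvt ga C pa
      · rw [psi1_b]; exact cvt gb B1 (Units.ext hP)
    · right
      refine ker_eq_s9 ψ psi2 (P * Q⁻¹) ?_ ?_
      · rw [psi2_a]; exact cvt ga C pa
      · rw [psi2_b]; exact cvt gb B2 (Units.ext hP)

private theorem lift_hom (φ : GammaO →* PSL(2, ZMod 23)) : ∃ ψ : GammaO →* S, pr.comp ψ = φ := by
  have hneg : pr (-1) = 1 := (pr_one_iff _).2 (Or.inr rfl)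
  have hneg' : ∀ x : S, pr (-x) = pr x := fun x => by
    rw [← neg_one_mul, map_mul, hneg, one_mul]
  obtain ⟨x, hx, hx3⟩ : ∃ x : S, pr x = φ ga ∧ x ^ 3 = 1 := by
    obtain ⟨x, hx⟩ := QuotientGroup.mk'_surjective (Subgroup.center S) (φ ga)
    have h : pr (x ^ 3) = 1 := by
      rw [map_pow]
      change (QuotientGroup.mk' (Subgroup.center S) x) ^ 3 = 1
      rw [hx, ← map_pow, ga3, map_one]
    rcases (pr_one_iff _).1 h with h | h
    · exact ⟨x, hx, h⟩
    · refine ⟨-x, (hneg' x).trans hx, ?_⟩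
      rw [Odd.neg_pow (by decide), h, neg_neg]
  obtain ⟨y, hy, hr⟩ : ∃ y : S, pr y = φ gb ∧ rel x y = 1 := by
    obtain ⟨y, hy⟩ := QuotientGroup.mk'_surjective (Subgroup.center S) (φ gb)
    have hy' : pr y = φ gb := hy
    have h : pr (rel x y) = 1 := by
      rw [rel_map, hx, hy', ← rel_map, grel, map_one]
    rcases (pr_one_iff _).1 h with h | h
    · exact ⟨y, hy, h⟩
    · refine ⟨-y, (hneg' y).trans hy, ?_⟩
      have : rel x (-y) = - rel x y := by
        have hi : (-y)⁻¹ = -y⁻¹ := inv_eq_of_mul_eq_one_right (by simp)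
        simp only [rel, hi, neg_sq, mul_neg, neg_mul]
      rw [this, h, neg_neg]
  refine ⟨gmk x y hx3 hr, g_ext _ _ ?_ ?_⟩
  · rw [MonoidHom.comp_apply, gmk_a, hx]
  · rw [MonoidHom.comp_apply, gmk_b, hy]

/-- `Γ¹_𝒪` has exactly two normal subgroups with quotient isomorphic to `PSL(2, 23)`,
i.e. exactly two subgroups arising as kernels of surjections onto `PSL(2, 23)`. -/
theorem GammaO_two_PSL2_23_quotients :
    {K : Subgroup GammaO | ∃ φ : GammaO →* PSL(2, ZMod 23),
      Function.Surjective φ ∧ φ.ker = K}.ncard = 2 := by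
  have : {K : Subgroup GammaO | ∃ φ : GammaO →* PSL(2, ZMod 23),
      Function.Surjective φ ∧ φ.ker = K} = {(pr.comp psi1).ker, (pr.comp psi2).ker} := by
    ext K
    constructor
    · rintro ⟨φ, hs, rfl⟩
      obtain ⟨ψ, rfl⟩ := lift_hom φ
      exact main_conj ψ hs
    · rintro (rfl | rfl)
      · exact ⟨_, surj1, rfl⟩
      · exact ⟨_, surj2, rfl⟩
  rw [this]
  exact Set.ncard_pair ker_ne
end

section
/- In the group PSL(2, 23): (i) there exists a subgroup of index 24; (ii) any two subgroups of index 24 are conjugate; and (iii) every subgroup of index 24 is maximal, i.e. it is not properly contained in any proper subgroup of PSL(2, 23). -/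
open scoped MatrixGroups Pointwise

instance fact23 : Fact (Nat.Prime 23) := ⟨by norm_num⟩

theorem card_SL : Nat.card SL(2, ZMod 23) = 12144 := by
  have h1 := Matrix.card_GL_field (𝔽 := ZMod 23) 2
  have h2 := Subgroup.card_eq_card_quotient_mul_card_subgroup
    (Matrix.GeneralLinearGroup.det (n := Fin 2) (R := ZMod 23)).ker
  have h3 := Nat.card_congr (QuotientGroup.quotientKerEquivOfSurjective
    (Matrix.GeneralLinearGroup.det (n := Fin 2) (R := ZMod 23))
    Matrix.GeneralLinearGroup.det_surjective).toEquiv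
  have h4 : Nat.card SL(2, ZMod 23) =
      Nat.card (Matrix.GeneralLinearGroup.det (n := Fin 2) (R := ZMod 23)).ker := by
    refine Nat.card_congr (Equiv.ofBijective
      (fun g => ⟨Matrix.SpecialLinearGroup.toGL g, Matrix.SpecialLinearGroup.coeToGL_det g⟩)
      ⟨fun a b h => Matrix.SpecialLinearGroup.toGL_injective (congrArg Subtype.val h), ?_⟩)
    rintro ⟨g, hg⟩
    refine ⟨⟨g.1, ?_⟩, ?_⟩
    · exact congrArg Units.val hg
    · apply Subtype.ext
      apply Units.ext
      rfl
  have h5 : Nat.card (ZMod 23)ˣ = 22 := by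
    rw [Nat.card_eq_fintype_card, ZMod.card_units_eq_totient, Nat.totient_prime fact23.out]
  rw [h3, h1, ← h4, h5, ZMod.card, Fin.prod_univ_two] at h2
  norm_num [-Nat.card_eq_fintype_card] at h2
  omega

theorem card_center : Nat.card (Subgroup.center SL(2, ZMod 23)) = 2 := by
  rw [Nat.card_congr (Matrix.SpecialLinearGroup.center_equiv_rootsOfUnity' (0 : Fin 2)).toEquiv]
  have h : IsPrimitiveRoot (-1 : ZMod 23) 2 := IsPrimitiveRoot.neg_one 23 (by norm_num)
  simpa using h.card_rootsOfUnity

theorem card_PSL : Nat.card PSL(2, ZMod 23) = 6072 := by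
  have h := Subgroup.card_eq_card_quotient_mul_card_subgroup (Subgroup.center SL(2, ZMod 23))
  rw [card_SL, card_center] at h
  change 12144 = Nat.card PSL(2, ZMod 23) * 2 at h
  omega

instance : IsSimpleGroup PSL(2, ZMod 23) :=
  Matrix.ProjectiveSpecialLinearGroup.rank_two_simple' ⟨2, by decide, by decide⟩

theorem mod_aux {n m : ℕ} (h : n ≡ 1 [MOD 23]) (hd : n ∣ 23 * m) : n ∣ m := by
  refine Nat.Coprime.dvd_of_dvd_mul_left ?_ hd
  rw [Nat.coprime_comm, Nat.Prime.coprime_iff_not_dvd fact23.out]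
  intro h2
  have := (Nat.modEq_zero_iff_dvd.2 h2).symm.trans h
  exact absurd this (by decide)

theorem sylow_card {G : Type*} [Group G] (hG : Nat.card G = 6072)
    (P : Sylow 23 G) : Nat.card P = 23 := by
  have : Finite G := Nat.finite_of_card_ne_zero (by omega)
  obtain ⟨k, hk⟩ := IsPGroup.iff_card.1 P.2
  have h1 : 23 ∣ Nat.card P := P.dvd_card_of_dvd_card (by rw [hG]; norm_num)
  have h2 : Nat.card P ∣ 6072 := hG ▸ Subgroup.card_subgroup_dvd_card (P : Subgroup G)
  change Nat.card P = _ at hk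
  rw [hk] at h1 h2 ⊢
  match k with
  | 0 => norm_num at h1
  | 1 => norm_num
  | k + 2 =>
    exfalso
    have : 23 ^ 2 ∣ 6072 := (pow_dvd_pow 23 (by omega)).trans h2
    norm_num at this

theorem normalizer_index {G : Type*} [Group G] (hG : Nat.card G = 6072)
    [IsSimpleGroup G] (P : Sylow 23 G) :
    (Subgroup.normalizer (P : Set G)).index = 24 := by
  have : Finite G := Nat.finite_of_card_ne_zero (by omega)
  have hP := sylow_card hG P
  have h1 := card_sylow_modEq_one 23 G
  rw [P.card_eq_index_normalizer] at h1
  have h2 : (Subgroup.normalizer (P : Set G)).index ∣ 264 := by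
    apply mod_aux h1
    have := Subgroup.index_dvd_card (Subgroup.normalizer (P : Set G))
    rw [hG] at this
    exact this
  have h3 : (Subgroup.normalizer (P : Set G)).index ≠ 1 := by
    intro h
    rw [Subgroup.index_eq_one] at h
    have hn : (P : Subgroup G).Normal := Subgroup.normalizer_eq_top_iff.1 h
    have hP' : Nat.card (P : Subgroup G) = 23 := hP
    rcases hn.eq_bot_or_eq_top with h | h
    · rw [h] at hP'; simp at hP'
    · rw [h] at hP'; simp [hG] at hP'
  have key : ∀ n ∈ Nat.divisors 264, n % 23 = 1 % 23 → n ≠ 1 → n = 24 := by decide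
  exact key _ (by simp [h2]) h1 h3

theorem index24_eq {G : Type*} [Group G] (hG : Nat.card G = 6072)
    [IsSimpleGroup G] (K : Subgroup G) (hK : K.index = 24) :
    ∃ P : Sylow 23 G, K = Subgroup.normalizer (P : Set G) := by
  have : Finite G := Nat.finite_of_card_ne_zero (by omega)
  have hKc : Nat.card K = 253 := by
    have := K.card_mul_index
    rw [hG, hK] at this
    omega
  obtain ⟨R⟩ : Nonempty (Sylow 23 K) := inferInstance
  obtain ⟨P, hP⟩ := R.exists_comap_subtype_eq
  have h1 : 23 ∣ Nat.card (R : Subgroup K) := R.dvd_card_of_dvd_card (by rw [hKc]; norm_num)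
  have hPc : Nat.card (P : Subgroup G) = 23 := sylow_card hG P
  have hPK : (P : Subgroup G) ≤ K := by
    have h2 : (R : Subgroup K).map K.subtype ≤ P := by
      rw [← hP]; exact Subgroup.map_comap_le _ _
    have h3 : Nat.card ((R : Subgroup K).map K.subtype) = Nat.card (R : Subgroup K) :=
      Subgroup.card_map_of_injective K.subtype_injective
    have h4 := Subgroup.eq_of_le_of_card_ge h2 (by
      rw [h3, hPc]; exact Nat.le_of_dvd Nat.card_pos h1)
    rw [← h4]
    exact Subgroup.map_subtype_le _
  refine ⟨P, ?_⟩
  have h5 := card_sylow_modEq_one 23 K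
  rw [(P.subtype hPK).card_eq_index_normalizer] at h5
  change (Subgroup.normalizer ((P.subtype hPK : Subgroup K) : Set K)).index ≡ _ [MOD _] at h5
  have h6 : (Subgroup.normalizer ((P.subtype hPK : Subgroup K) : Set K)).index ∣ 11 := by
    apply mod_aux h5
    have := Subgroup.index_dvd_card (Subgroup.normalizer ((P.subtype hPK : Subgroup K) : Set K))
    rw [hKc] at this
    exact this
  have key : ∀ n ∈ Nat.divisors 11, n % 23 = 1 % 23 → n = 1 := by decide
  have h7 := key _ (Nat.mem_divisors.2 ⟨h6, by norm_num⟩) h5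
  rw [Subgroup.index_eq_one, Sylow.coe_subtype, Subgroup.normalizer_eq_top_iff,
    Subgroup.normal_subgroupOf_iff_le_normalizer hPK] at h7
  apply Subgroup.eq_of_le_of_card_ge h7
  have h8 := (Subgroup.normalizer (P : Set G)).card_mul_index
  rw [normalizer_index hG P, hG] at h8
  have : Nat.card (Subgroup.normalizer (P : Set G)) = 253 := by omega
  exact (this.trans hKc.symm).le

theorem max_aux {G : Type*} [Group G] (hG : Nat.card G = 6072)
    [IsSimpleGroup G] (K L : Subgroup G) (hK : K.index = 24) (hKL : K < L) :
    L = ⊤ := by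
  have : Finite G := Nat.finite_of_card_ne_zero (by omega)
  obtain ⟨P, hP⟩ := index24_eq hG K hK
  have hPL : (P : Subgroup G) ≤ L := (Subgroup.le_normalizer.trans hP.ge).trans hKL.le
  have h5 := card_sylow_modEq_one 23 L
  rw [(P.subtype hPL).card_eq_index_normalizer] at h5
  have h6 : Subgroup.normalizer ((P.subtype hPL : Subgroup L) : Set L) = K.subgroupOf L := by
    rw [hP, Sylow.coe_subtype]
    exact (Subgroup.subgroupOf_normalizer_eq hPL).symm
  change (Subgroup.normalizer ((P.subtype hPL : Subgroup L) : Set L)).index ≡ _ [MOD _] at h5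
  rw [h6] at h5
  change K.relIndex L ≡ _ [MOD _] at h5
  have h7 : K.relIndex L * L.index = 24 := by
    rw [Subgroup.relIndex_mul_index hKL.le, hK]
  have h8 : K.relIndex L ≠ 1 := fun h => hKL.not_ge (Subgroup.relIndex_eq_one.1 h)
  have key : ∀ n ∈ Nat.divisors 24, n % 23 = 1 % 23 → n ≠ 1 → n = 24 := by decide
  have h9 := key _ (Nat.mem_divisors.2 ⟨Dvd.intro _ h7, by norm_num⟩) h5 h8
  rw [h9] at h7
  exact Subgroup.index_eq_one.1 (by omega)

theorem conj_aux {G : Type*} [Group G] (hG : Nat.card G = 6072)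
    [IsSimpleGroup G] (K₁ K₂ : Subgroup G) (h₁ : K₁.index = 24)
    (h₂ : K₂.index = 24) : ∃ g : G, MulAut.conj g • K₁ = K₂ := by
  have : Finite G := Nat.finite_of_card_ne_zero (by omega)
  obtain ⟨P, rfl⟩ := index24_eq hG K₁ h₁
  obtain ⟨Q, rfl⟩ := index24_eq hG K₂ h₂
  obtain ⟨g, rfl⟩ := MulAction.exists_smul_eq G P Q
  refine ⟨g, ?_⟩
  rw [← Sylow.stabilizer_eq_normalizer, ← Sylow.stabilizer_eq_normalizer,
    MulAction.stabilizer_smul_eq_stabilizer_map_conj]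
  rfl

theorem PSL2_23_index24_subgroups :
    (∃ K : Subgroup PSL(2, ZMod 23), K.index = 24) ∧
      (∀ K₁ K₂ : Subgroup PSL(2, ZMod 23), K₁.index = 24 → K₂.index = 24 →
        ∃ g : PSL(2, ZMod 23), MulAut.conj g • K₁ = K₂) ∧
      ∀ K L : Subgroup PSL(2, ZMod 23), K.index = 24 → K < L → L = ⊤ := by
  obtain ⟨P⟩ : Nonempty (Sylow 23 PSL(2, ZMod 23)) := inferInstance
  exact ⟨⟨_, normalizer_index card_PSL P⟩, conj_aux card_PSL, max_aux card_PSL⟩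
end

section
/- Let k = ℚ[X]/(X³ − X² + 1) with ring of integers 𝒪_k. Then there exist distinct prime ideals 𝔭 and 𝔮 of 𝒪_k, each of absolute norm 23, such that the ideal generated by 23 in 𝒪_k factors as (23)𝒪_k = 𝔭²·𝔮; moreover 𝔭 and 𝔮 are the only prime ideals of 𝒪_k of absolute norm 23. -/
open Polynomial NumberField

/-- In the ring of integers of `k = ℚ[X]/(X³ − X² + 1)` there are exactly two prime ideals
of absolute norm 23, one ramified and one split: `(23) = 𝔭²·𝔮`. -/
theorem primes_above_23 (k : Type) [Field k] [NumberField k]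
    (hk : Nonempty (k ≃+* AdjoinRoot (X ^ 3 - X ^ 2 + 1 : ℚ[X]))) :
    ∃ p q : Ideal (𝓞 k), p ≠ q ∧ p.IsPrime ∧ q.IsPrime ∧
      Ideal.absNorm p = 23 ∧ Ideal.absNorm q = 23 ∧
      Ideal.span {(23 : 𝓞 k)} = p ^ 2 * q ∧
      ∀ r : Ideal (𝓞 k), r.IsPrime → Ideal.absNorm r = 23 → r = p ∨ r = q := by
  obtain ⟨e⟩ := hk
  set f : ℚ[X] := X ^ 3 - X ^ 2 + 1 with hf
  have hdeg : f.natDegree = 3 := by rw [hf]; compute_degree!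
  have hf0 : f ≠ 0 := by
    intro h; rw [h] at hdeg; simp at hdeg
  let e' : AdjoinRoot f ≃ₐ[ℚ] k := AlgEquiv.ofRingEquiv (f := e.symm) (fun q =>
    eq_ratCast ((e.symm : AdjoinRoot f →+* k).comp (AdjoinRoot.of f)) q |>.trans (by simp))
  have hfin : Module.finrank ℚ k = 3 := by
    rw [← e'.toLinearEquiv.finrank_eq, (AdjoinRoot.powerBasis hf0).finrank]
    simpa using hdeg
  set t : k := e' (AdjoinRoot.root f) with ht
  have ht3 : t ^ 3 - t ^ 2 + 1 = 0 := by
    have h := AdjoinRoot.eval₂_root f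
    have h2 := congrArg e' h
    simpa [hf] using h2
  have htop : Algebra.adjoin ℚ {3 * t - 2} = ⊤ := by
    have h1 : Algebra.adjoin ℚ {t} = ⊤ := by
      have := congrArg (Subalgebra.map (e' : AdjoinRoot f →ₐ[ℚ] k))
        (AdjoinRoot.adjoinRoot_eq_top (R := ℚ) (f := f))
      rw [AlgHom.map_adjoin_singleton, Algebra.map_top] at this
      refine this.trans ?_
      rw [AlgHom.range_eq_top]
      exact e'.surjective
    rw [eq_top_iff, ← h1]
    apply Algebra.adjoin_le
    rintro x rfl
    have h3 : t = (1/3 : ℚ) • (3 * t - 2) + algebraMap ℚ k (2/3) := by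
      rw [Algebra.smul_def]; simp; ring
    change t ∈ Algebra.adjoin ℚ {3 * t - 2}
    rw [h3]
    refine add_mem (Subalgebra.smul_mem _ ?_ _) (Subalgebra.algebraMap_mem _ _)
    rw [← h3]
    exact Algebra.self_mem_adjoin_singleton _ _
  have hu : (3 * t - 2) ^ 3 + 3 * (3 * t - 2) ^ 2 + 23 = 0 := by linear_combination 27 * ht3
  generalize 3 * t - 2 = u at htop hu
  have huint : IsIntegral ℤ u := by
    refine ⟨X ^ 3 + 3 * X ^ 2 + 23, by monicity!, ?_⟩
    simpa using hu
  have hmin : minpoly ℚ u = X ^ 3 + 3 * X ^ 2 + 23 := by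
    have hint : IsIntegral ℚ u := Algebra.IsIntegral.isIntegral u
    symm
    apply Polynomial.eq_of_monic_of_dvd_of_natDegree_le (minpoly.monic hint) (by monicity!)
    · apply minpoly.dvd
      rw [map_add, map_add, map_mul, map_pow, map_pow, aeval_X, map_ofNat (aeval u) 3,
        map_ofNat (aeval u) 23]
      exact hu
    · have := (PowerBasis.ofAdjoinEqTop hint htop).finrank
      rw [hfin, PowerBasis.ofAdjoinEqTop_dim] at this
      rw [← this]
      compute_degree!
  have hnorm : Algebra.norm ℚ u = -23 := by
    have hint : IsIntegral ℚ u := Algebra.IsIntegral.isIntegral u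
    have := Algebra.PowerBasis.norm_gen_eq_coeff_zero_minpoly (PowerBasis.ofAdjoinEqTop hint htop)
    rw [PowerBasis.ofAdjoinEqTop_gen, ← PowerBasis.finrank, hfin, hmin] at this
    rw [this]
    simp [coeff_zero_eq_eval_zero]
    norm_num
  let a : 𝓞 k := ⟨u, huint⟩
  have ha : a ^ 3 + 3 * a ^ 2 + 23 = 0 := by
    apply RingOfIntegers.ext
    change algebraMap (𝓞 k) k (a ^ 3 + 3 * a ^ 2 + 23) = algebraMap (𝓞 k) k 0
    rw [map_add, map_add, map_mul, map_pow, map_pow, map_ofNat (algebraMap (𝓞 k) k) 3,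
      map_ofNat (algebraMap (𝓞 k) k) 23, map_zero]
    exact hu
  have hna : Algebra.norm ℤ a = -23 := by
    have := Algebra.coe_norm_int a
    have h2 : ((Algebra.norm ℤ a : ℤ) : ℚ) = ((-23 : ℤ) : ℚ) := by
      rw [this]; push_cast; exact hnorm
    exact_mod_cast h2
  have hP : Ideal.absNorm (Ideal.span {a}) = 23 := by
    rw [Ideal.absNorm_span_singleton, hna]; rfl
  have hfac : Ideal.span {(23 : 𝓞 k)} = Ideal.span {a} ^ 2 * Ideal.span {a + 3} := by
    rw [Ideal.span_singleton_pow, Ideal.span_singleton_mul_span_singleton,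
      ← Ideal.span_singleton_neg]
    congr 2
    linear_combination -ha
  have hQ : Ideal.absNorm (Ideal.span {a + 3}) = 23 := by
    have h := congrArg Ideal.absNorm hfac
    have h23 := Ideal.absNorm_span_natCast (S := 𝓞 k) 23
    rw [RingOfIntegers.rank, hfin] at h23
    rw [map_mul, map_pow, hP] at h
    push_cast at h23
    rw [h23] at h
    omega
  have hirr : Irreducible (23 : ℕ) := (by norm_num : Nat.Prime 23)
  have hPp : (Ideal.span {a}).IsPrime := Ideal.isPrime_of_irreducible_absNorm (by rw [hP]; exact hirr)
  have hQp : (Ideal.span {a + 3}).IsPrime :=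
    Ideal.isPrime_of_irreducible_absNorm (by rw [hQ]; exact hirr)
  have key : ∀ p r : Ideal (𝓞 k), p.IsPrime → r.IsPrime → Ideal.absNorm p = 23 → p ≤ r → r = p := by
    intro p r hp hr hn hle
    have hp0 : p ≠ ⊥ := by rintro rfl; simp at hn
    exact ((hp.isMaximal hp0).eq_of_le hr.ne_top hle).symm
  refine ⟨Ideal.span {a}, Ideal.span {a + 3}, ?_, hPp, hQp, hP, hQ, hfac, ?_⟩
  · intro h
    apply hPp.ne_top
    rw [Ideal.eq_top_iff_one]
    have h1 : a ∈ Ideal.span {a} := Ideal.mem_span_singleton_self a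
    have h2 : a + 3 ∈ Ideal.span {a} := by rw [h]; exact Ideal.mem_span_singleton_self _
    have h4 : (1 : 𝓞 k) = (8 + a ^ 2 + 3 * a - 8) * a + 8 * (a + 3) - 8 * a := by
      linear_combination -ha
    rw [h4]
    exact sub_mem (add_mem (Ideal.mul_mem_left _ _ h1) (Ideal.mul_mem_left _ _ h2))
      (Ideal.mul_mem_left _ _ h1)
  · intro r hr hn
    have hmem := Ideal.absNorm_mem r
    rw [hn] at hmem
    have hle : Ideal.span {(23 : 𝓞 k)} ≤ r := by
      rw [Ideal.span_singleton_le_iff_mem]; exact_mod_cast hmem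
    rw [hfac, hr.mul_le] at hle
    rcases hle with h | h
    · exact Or.inl (key _ _ hPp hr hP (hr.le_of_pow_le h))
    · exact Or.inr (key _ _ hQp hr hQ h)
end
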